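/- Let q ∈ ℂ be nonzero and not a root of unity, let A be a unital associative ℂ-algebra, and let a, b, c, d ∈ A satisfy the SL_q(2) relations. Set ζ := −q⁻¹bc. Then for every natural number n, $\sum_{k=0}^{n}\binom{n}{k}_{q^2}\,(-q)^{-k}\,b^{k}d^{n-k}a^{n-k}c^{k} \;=\; \sum_{m=0}^{n}\zeta^{m}\sum_{k=0}^{m}\binom{n}{k}_{q^2}\,(-1)^{m-k}\,q^{2(m-k)}\,q^{(m-k)(m-k-1)}\binom{n-k}{m-k}_{q^{2}}$. (This expresses the trace of the projector $e_{n}$ as an explicit polynomial in ζ with scalar coefficients.) -/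

import Mathlib

/-- The `x`-binomial coefficient
`(x-1)(x²-1)⋯(xⁿ-1) / [(x-1)⋯(x^k-1) · (x-1)⋯(x^(n-k)-1)]`. -/
noncomputable def qbin (x : ℂ) (n k : ℕ) : ℂ :=
  (∏ i ∈ Finset.range n, (x ^ (i + 1) - 1)) /
    ((∏ i ∈ Finset.range k, (x ^ (i + 1) - 1)) *
      (∏ i ∈ Finset.range (n - k), (x ^ (i + 1) - 1)))

theorem qbin_zero_right {x : ℂ} (hx : ∀ i : ℕ, x ^ (i + 1) - 1 ≠ 0) (n : ℕ) :
    qbin x n 0 = 1 := by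
  simp [qbin, div_self (Finset.prod_ne_zero_iff.2 fun i _ => hx i)]

theorem qbin_self {x : ℂ} (hx : ∀ i : ℕ, x ^ (i + 1) - 1 ≠ 0) (n : ℕ) :
    qbin x n n = 1 := by
  simp [qbin, div_self (Finset.prod_ne_zero_iff.2 fun i _ => hx i)]

theorem qbin_succ_succ {x : ℂ} (hx : ∀ i : ℕ, x ^ (i + 1) - 1 ≠ 0) {n l : ℕ} (h : l < n) :
    qbin x (n + 1) (l + 1) = qbin x n (l + 1) + x ^ (n - l) * qbin x n l := by
  obtain ⟨r, rfl⟩ := Nat.exists_eq_add_of_lt h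
  have hD (m : ℕ) : ∏ i ∈ Finset.range m, (x ^ (i + 1) - 1) ≠ 0 :=
    Finset.prod_ne_zero_iff.2 fun i _ => hx i
  have h₁ : l + r + 1 + 1 - (l + 1) = r + 1 := by omega
  have h₂ : l + r + 1 - (l + 1) = r := by omega
  have h₃ : l + r + 1 - l = r + 1 := by omega
  simp only [qbin, h₁, h₂, h₃]
  rw [Finset.prod_range_succ _ (l + r + 1), Finset.prod_range_succ _ l,
    Finset.prod_range_succ _ r]
  have hl := hD l
  have hr := hD r
  have hxl := hx l
  have hxr := hx r
  field_simp
  ring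

/-- The coefficient of `z ^ l` in `∏ i < j, (1 - q ^ (2 * (i + 1)) * z)`. -/
noncomputable def qPochhammerCoeff (q : ℂ) (j l : ℕ) : ℂ :=
  (-1 : ℂ) ^ l * q ^ (2 * l) * q ^ (l * (l - 1)) * qbin (q ^ 2) j l

theorem qPochhammerCoeff_zero_right {q : ℂ} (hx : ∀ i : ℕ, (q ^ 2) ^ (i + 1) - 1 ≠ 0)
    (j : ℕ) : qPochhammerCoeff q j 0 = 1 := by
  simp [qPochhammerCoeff, qbin_zero_right hx]

theorem qPochhammerCoeff_succ_self {q : ℂ} (hx : ∀ i : ℕ, (q ^ 2) ^ (i + 1) - 1 ≠ 0)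
    (j : ℕ) :
    qPochhammerCoeff q (j + 1) (j + 1) = -q ^ (2 * (j + 1)) * qPochhammerCoeff q j j := by
  simp only [qPochhammerCoeff, qbin_self hx]
  rcases j with _ | j
  · simp
  · simp only [Nat.add_sub_cancel]
    ring

theorem qPochhammerCoeff_succ_succ {q : ℂ} (hx : ∀ i : ℕ, (q ^ 2) ^ (i + 1) - 1 ≠ 0)
    {j l : ℕ} (h : l < j) :
    qPochhammerCoeff q (j + 1) (l + 1) =
      qPochhammerCoeff q j (l + 1) - q ^ (2 * (j + 1)) * qPochhammerCoeff q j l := by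
  obtain ⟨r, rfl⟩ := Nat.exists_eq_add_of_lt h
  have hr : l + r + 1 - l = r + 1 := by omega
  simp only [qPochhammerCoeff, qbin_succ_succ hx h, hr]
  rcases l with _ | l
  · simp only [Nat.add_sub_cancel]
    ring
  · simp only [Nat.add_sub_cancel]
    ring

theorem one_sub_smul_mul_sum_qPochhammerCoeff {q : ℂ} (hx : ∀ i : ℕ, (q ^ 2) ^ (i + 1) - 1 ≠ 0)
    {A : Type*} [Ring A] [Algebra ℂ A] (z : A) (j : ℕ) :
    (1 - q ^ (2 * (j + 1)) • z) *
        ∑ l ∈ Finset.range (j + 1), qPochhammerCoeff q j l • z ^ l =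
      ∑ l ∈ Finset.range (j + 2), qPochhammerCoeff q (j + 1) l • z ^ l := by
  have hmul : q ^ (2 * (j + 1)) • z * ∑ l ∈ Finset.range (j + 1), qPochhammerCoeff q j l • z ^ l =
      ∑ l ∈ Finset.range (j + 1), (q ^ (2 * (j + 1)) * qPochhammerCoeff q j l) • z ^ (l + 1) := by
    simp only [Finset.mul_sum, smul_mul_smul_comm, pow_succ']
  have hsucc : ∑ l ∈ Finset.range j, qPochhammerCoeff q (j + 1) (l + 1) • z ^ (l + 1) =
      ∑ l ∈ Finset.range j, qPochhammerCoeff q j (l + 1) • z ^ (l + 1) -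
        ∑ l ∈ Finset.range j, (q ^ (2 * (j + 1)) * qPochhammerCoeff q j l) • z ^ (l + 1) := by
    rw [← Finset.sum_sub_distrib]
    refine Finset.sum_congr rfl fun l hl => ?_
    rw [qPochhammerCoeff_succ_succ hx (Finset.mem_range.1 hl), sub_smul]
  rw [sub_mul, one_mul, hmul, Finset.sum_range_succ', Finset.sum_range_succ _ j,
    Finset.sum_range_succ' _ (j + 1), Finset.sum_range_succ _ j, hsucc,
    qPochhammerCoeff_succ_self hx, qPochhammerCoeff_zero_right hx, qPochhammerCoeff_zero_right hx,
    neg_mul, neg_smul]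
  abel

/-- If `d z = q² z d` and `d a = 1 - q² z`, then `d ^ j a ^ j = ∏ i < j, (1 - q ^ (2 * (i + 1)) z)`,
in expanded form. -/
theorem pow_mul_pow_eq_sum_qPochhammerCoeff {q : ℂ} (hx : ∀ i : ℕ, (q ^ 2) ^ (i + 1) - 1 ≠ 0)
    {A : Type*} [Ring A] [Algebra ℂ A] {a d z : A}
    (hdz : d * z = q ^ 2 • (z * d)) (hda : d * a = 1 - q ^ 2 • z) (j : ℕ) :
    d ^ j * a ^ j = ∑ l ∈ Finset.range (j + 1), qPochhammerCoeff q j l • z ^ l := by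
  have hpow (i : ℕ) : d ^ i * z = q ^ (2 * i) • (z * d ^ i) := by
    induction i with
    | zero => simp
    | succ i ih =>
      rw [pow_succ, mul_assoc, hdz, mul_smul_comm, ← mul_assoc, ih, smul_mul_assoc, smul_smul,
        mul_assoc]
      congr 1
      ring
  induction j with
  | zero => simp [qPochhammerCoeff_zero_right hx]
  | succ j ih =>
    rw [← one_sub_smul_mul_sum_qPochhammerCoeff hx, ← ih, pow_succ, pow_succ', mul_assoc,
      ← mul_assoc d, hda, sub_mul, one_mul, mul_sub, sub_mul, one_mul, smul_mul_assoc,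
      mul_smul_comm, ← mul_assoc (d ^ j), hpow, smul_mul_assoc, smul_smul, smul_mul_assoc,
      mul_assoc z]
    congr 2
    ring

theorem stmt7 (q : ℂ) (hq : q ≠ 0) (hroot : ∀ k : ℕ, 0 < k → q ^ k ≠ 1)
    (A : Type*) [Ring A] [Algebra ℂ A] (a b c d : A)
    (hab : a * b = q⁻¹ • (b * a)) (hac : a * c = q⁻¹ • (c * a))
    (hbd : b * d = q⁻¹ • (d * b)) (hbc : b * c = c * b)
    (hcd : c * d = q⁻¹ • (d * c))
    (hadda : a * d - d * a = (q⁻¹ - q) • (b * c))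
    (had : a * d - q⁻¹ • (b * c) = 1) (hda : d * a - q • (b * c) = 1)
    (ζ : A) (hζ : ζ = (-q⁻¹) • (b * c)) (n : ℕ) :
    ∑ k ∈ Finset.range (n + 1),
      (qbin (q ^ 2) n k * (-q) ^ (-(k : ℤ))) • (b ^ k * d ^ (n - k) * a ^ (n - k) * c ^ k)
    = ∑ m ∈ Finset.range (n + 1),
        (∑ k ∈ Finset.range (m + 1),
          qbin (q ^ 2) n k * (-1 : ℂ) ^ (m - k) * q ^ (2 * (m - k)) *
            q ^ ((m - k) * (m - k - 1)) * qbin (q ^ 2) (n - k) (m - k)) •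
          ζ ^ m := by
  have hx (i : ℕ) : (q ^ 2) ^ (i + 1) - 1 ≠ 0 := by
    rw [← pow_mul, sub_ne_zero]
    exact hroot _ (by omega)
  have hbcζ : b * c = (-q) • ζ := by
    rw [hζ, smul_smul, neg_mul_neg, mul_inv_cancel₀ hq, one_smul]
  have hdb : d * b = q • (b * d) := by
    rw [hbd, smul_smul, mul_inv_cancel₀ hq, one_smul]
  have hdc : d * c = q • (c * d) := by
    rw [hcd, smul_smul, mul_inv_cancel₀ hq, one_smul]
  have hdζ : d * ζ = q ^ 2 • (ζ * d) := by
    rw [hζ, mul_smul_comm, ← mul_assoc, hdb, smul_mul_assoc, mul_assoc, hdc]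
    simp only [mul_smul_comm, smul_mul_assoc, smul_smul, mul_assoc]
    congr 1
    ring
  have hdaζ : d * a = 1 - q ^ 2 • ζ := by
    rw [eq_add_of_sub_eq hda, hbcζ, smul_smul, sub_eq_add_neg, ← neg_smul]
    congr 2
    ring
  have hbζ : Commute b ζ := by
    rw [hζ]
    exact ((Commute.refl b).mul_right hbc).smul_right _
  have hterm (k : ℕ) (P : ℂ) (j : ℕ) :
      (P * (-q) ^ (-(k : ℤ))) • (b ^ k * d ^ j * a ^ j * c ^ k) =
        ∑ l ∈ Finset.range (j + 1), (P * qPochhammerCoeff q j l) • ζ ^ (k + l) := by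
    have hcomm : Commute (b ^ k) (d ^ j * a ^ j) := by
      rw [pow_mul_pow_eq_sum_qPochhammerCoeff hx hdζ hdaζ]
      exact Commute.sum_right _ _ _ fun l _ => (hbζ.pow_pow k l).smul_right _
    rw [mul_assoc (b ^ k), hcomm.eq, mul_assoc, ← Commute.mul_pow hbc, hbcζ, smul_pow,
      mul_smul_comm, smul_smul, mul_assoc, zpow_neg, zpow_natCast,
      inv_mul_cancel₀ (pow_ne_zero _ (neg_ne_zero.2 hq)), mul_one,
      pow_mul_pow_eq_sum_qPochhammerCoeff hx hdζ hdaζ, Finset.sum_mul, Finset.smul_sum]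
    refine Finset.sum_congr rfl fun l _ => ?_
    rw [smul_mul_assoc, smul_smul, ← pow_add, add_comm]
  calc
    _ = ∑ k ∈ Finset.range (n + 1), ∑ l ∈ Finset.range (n + 1 - k),
        (qbin (q ^ 2) n k * qPochhammerCoeff q (n - k) l) • ζ ^ (k + l) := by
      refine Finset.sum_congr rfl fun k hk => ?_
      rw [hterm, Nat.sub_add_comm (Nat.lt_succ_iff.1 (Finset.mem_range.1 hk))]
    _ = _ := by
      rw [← Finset.sum_range_diag_flip]
      refine Finset.sum_congr rfl fun m _ => ?_
      rw [Finset.sum_smul]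
      refine Finset.sum_congr rfl fun k hk => ?_
      rw [Nat.add_sub_cancel' (Nat.lt_succ_iff.1 (Finset.mem_range.1 hk))]
      simp only [qPochhammerCoeff, mul_assoc]
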